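/- arXiv:1212.5397 — 3 statements merged into one kernel-verified Lean document; each statement's English description precedes it below -/
import Mathlib

section
/- Let U be uniformly distributed on [0,1], let V = 1 − U, fix q ∈ [0,1], and set ξ_{t,1} = (𝟙_{U<q}, 𝟙_{U≥q})' and ξ_{t,2} = (𝟙_{V<q}, 𝟙_{V≥q})'. Then the expected squared Euclidean distance between the two antithetic samples satisfies E[d²(ξ_{t,1}, ξ_{t,2})] = 2 − 2·((2q−1)·𝟙_{q>1/2} + (1−2q)·𝟙_{q<1/2}). -/
open MeasureTheory Set

/-- The squared distance between the indicator pairs `(𝟙_{u<q}, 𝟙_{u≥q})` and `(𝟙_{v<q}, 𝟙_{v≥q})`,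
`v = 1 - u`, is `0` when `u` and `v` lie on the same side of `q`, and `2` otherwise. -/
lemma sq_dist_antithetic_eq_indicator (q u : ℝ) :
    ((if u < q then (1 : ℝ) else 0) - (if 1 - u < q then (1 : ℝ) else 0)) ^ 2
        + ((if q ≤ u then (1 : ℝ) else 0) - (if q ≤ 1 - u then (1 : ℝ) else 0)) ^ 2
      = 2 - 2 * ((Set.Ioo (1 - q) q).indicator (fun _ => (1 : ℝ)) u
          + (Set.Icc q (1 - q)).indicator (fun _ => (1 : ℝ)) u) := by
  simp only [Set.indicator_apply, Set.mem_Ioo, Set.mem_Icc]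
  grind

/-- The integral over `[0, 1]` of the indicator of a measurable subset. -/
lemma setIntegral_unitInterval_indicator_one {s : Set ℝ} (hs : MeasurableSet s)
    (h : s ⊆ Set.Icc 0 1) :
    ∫ u in Set.Icc (0 : ℝ) 1, s.indicator (fun _ => (1 : ℝ)) u = volume.real s := by
  rw [integral_indicator_const _ hs, measureReal_restrict_apply hs,
    Set.inter_eq_left.mpr h, smul_eq_mul, mul_one]

/-- Expected squared Euclidean distance between the two backward antithetic samples
`ξ_{t,1} = (𝟙_{U<q}, 𝟙_{U≥q})'` and `ξ_{t,2} = (𝟙_{V<q}, 𝟙_{V≥q})'` with `V = 1 - U`: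
`E[d²(ξ_{t,1}, ξ_{t,2})] = 2 − 2((2q−1)𝟙_{q>1/2} + (1−2q)𝟙_{q<1/2})`. -/
theorem expected_sq_dist_antithetic_samples
    {Ω : Type*} [MeasurableSpace Ω] (P : Measure Ω) [IsProbabilityMeasure P]
    (U : Ω → ℝ) (hmU : Measurable U)
    (hU : Measure.map U P = volume.restrict (Set.Icc (0 : ℝ) 1))
    (q : ℝ) (hq : q ∈ Set.Icc (0 : ℝ) 1) :
    ∫ ω, (((if U ω < q then (1 : ℝ) else 0) - (if 1 - U ω < q then (1 : ℝ) else 0)) ^ 2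
          + ((if q ≤ U ω then (1 : ℝ) else 0) - (if q ≤ 1 - U ω then (1 : ℝ) else 0)) ^ 2) ∂P
    = 2 - 2 * ((2 * q - 1) * (if 1 / 2 < q then (1 : ℝ) else 0)
               + (1 - 2 * q) * (if q < 1 / 2 then (1 : ℝ) else 0)) := by
  obtain ⟨hq0, hq1⟩ := hq
  simp only [sq_dist_antithetic_eq_indicator]
  have hint : ∀ s : Set ℝ, MeasurableSet s →
      Integrable (s.indicator fun _ => (1 : ℝ)) (volume.restrict (Set.Icc (0 : ℝ) 1)) :=
    fun s hs => (integrable_const 1).indicator hs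
  have hIoo := hint (Set.Ioo (1 - q) q) measurableSet_Ioo
  have hIcc := hint (Set.Icc q (1 - q)) measurableSet_Icc
  have hsum : Integrable (fun u => (Set.Ioo (1 - q) q).indicator (fun _ => (1 : ℝ)) u
      + (Set.Icc q (1 - q)).indicator (fun _ => (1 : ℝ)) u)
      (volume.restrict (Set.Icc (0 : ℝ) 1)) := hIoo.add hIcc
  have hmap := integral_map (μ := P) hmU.aemeasurable
    (f := fun u => 2 - 2 * ((Set.Ioo (1 - q) q).indicator (fun _ => (1 : ℝ)) u
          + (Set.Icc q (1 - q)).indicator (fun _ => (1 : ℝ)) u))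
    (by
      rw [hU]
      exact ((integrable_const 2).sub (hsum.const_mul 2)).aestronglyMeasurable)
  rw [← hmap, hU, integral_sub (integrable_const 2) (hsum.const_mul 2),
    integral_const_mul, integral_add hIoo hIcc,
    setIntegral_unitInterval_indicator_one measurableSet_Ioo
      (fun u hu => ⟨by linarith [hu.1], by linarith [hu.2]⟩),
    setIntegral_unitInterval_indicator_one measurableSet_Icc
      (fun u hu => ⟨by linarith [hu.1], by linarith [hu.2]⟩),
    measureReal_def, measureReal_def, Real.volume_Ioo, Real.volume_Icc,
    ENNReal.toReal_ofReal', ENNReal.toReal_ofReal']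
  rcases lt_trichotomy q (1 / 2) with h | h | h
  · rw [max_eq_right (by linarith), max_eq_left (by linarith), if_neg h.le.not_gt, if_pos h]
    simp
    ring
  · subst h
    norm_num
  · rw [max_eq_left (by linarith), max_eq_right (by linarith), if_pos h, if_neg h.le.not_gt]
    simp
    ring
end

section
/- Let U be uniformly distributed on [0,1], let V = 1 − U, and for q ∈ [0,1] set ξ_{t,1} = (𝟙_{U<q}, 𝟙_{U≥q})' and ξ_{t,2} = (𝟙_{V<q}, 𝟙_{V≥q})'. Then E[d²(ξ_{t,1}, ξ_{t,2})] ≤ 2 for every q ∈ [0,1], and equality (extreme antithesis) holds if and only if q = 1/2. -/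
open MeasureTheory Set

/-- The squared distance between the antithetic samples driven by the uniform value `u`. -/
noncomputable def antitheticSqDist (q u : ℝ) : ℝ :=
  ((if u < q then (1 : ℝ) else 0) - (if 1 - u < q then (1 : ℝ) else 0)) ^ 2
    + ((if q ≤ u then (1 : ℝ) else 0) - (if q ≤ 1 - u then (1 : ℝ) else 0)) ^ 2

lemma antitheticSqDist_eq (q u : ℝ) :
    antitheticSqDist q u = 2 - (Ioo (1 - q) q).indicator (fun _ => (2 : ℝ)) u
      - (Icc q (1 - q)).indicator (fun _ => (2 : ℝ)) u := by
  simp only [antitheticSqDist, indicator_apply, mem_Ioo, mem_Icc]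
  split_ifs <;> grind

lemma measurable_antitheticSqDist (q : ℝ) : Measurable (antitheticSqDist q) := by
  rw [funext (antitheticSqDist_eq q)]
  exact (measurable_const.sub (measurable_const.indicator measurableSet_Ioo)).sub
    (measurable_const.indicator measurableSet_Icc)

lemma integral_antitheticSqDist {q : ℝ} (hq : q ∈ Icc (0 : ℝ) 1) :
    ∫ u in Icc (0 : ℝ) 1, antitheticSqDist q u
      = 2 - 2 * max (2 * q - 1) 0 - 2 * max (1 - 2 * q) 0 := by
  have hIoo : Ioo (1 - q) q ∩ Icc 0 1 = Ioo (1 - q) q :=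
    inter_eq_left.2 fun x hx => ⟨by linarith [hx.1, hq.2], by linarith [hx.2, hq.2]⟩
  have hIcc : Icc q (1 - q) ∩ Icc 0 1 = Icc q (1 - q) :=
    inter_eq_left.2 fun x hx => ⟨by linarith [hx.1, hq.1], by linarith [hx.2, hq.1]⟩
  have hc : Integrable (fun _ : ℝ => (2 : ℝ)) (volume.restrict (Icc 0 1)) :=
    integrable_const _
  have h₁ : Integrable (fun u => (Ioo (1 - q) q).indicator (fun _ => (2 : ℝ)) u)
      (volume.restrict (Icc 0 1)) := hc.indicator measurableSet_Ioo
  have h₂ : Integrable (fun u => (Icc q (1 - q)).indicator (fun _ => (2 : ℝ)) u)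
      (volume.restrict (Icc 0 1)) := hc.indicator measurableSet_Icc
  have h₃ : Integrable (fun u => 2 - (Ioo (1 - q) q).indicator (fun _ => (2 : ℝ)) u)
      (volume.restrict (Icc 0 1)) := hc.sub h₁
  simp_rw [antitheticSqDist_eq]
  rw [integral_sub h₃ h₂, integral_sub hc h₁,
    integral_indicator_const _ measurableSet_Ioo, integral_indicator_const _ measurableSet_Icc,
    measureReal_restrict_apply measurableSet_Ioo, measureReal_restrict_apply measurableSet_Icc,
    hIoo, hIcc]
  simp only [integral_const, measureReal_def, Real.volume_Ioo,
    Real.volume_Icc, ENNReal.toReal_ofReal', smul_eq_mul]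
  rw [show q - (1 - q) = 2 * q - 1 by ring, show 1 - q - q = 1 - 2 * q by ring]
  norm_num
  ring

/-- The expected squared Euclidean distance between the two backward antithetic samples is at
most `2` for every filtered probability `q ∈ [0,1]`, with equality (extreme antithesis) if and
only if `q = 1/2`. -/
theorem expected_sq_dist_antithetic_le_two_iff
    {Ω : Type*} [MeasurableSpace Ω] (P : Measure Ω) [IsProbabilityMeasure P]
    (U : Ω → ℝ) (hmU : Measurable U)
    (hU : Measure.map U P = volume.restrict (Set.Icc (0 : ℝ) 1))
    (q : ℝ) (hq : q ∈ Set.Icc (0 : ℝ) 1) :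
    (∫ ω, (((if U ω < q then (1 : ℝ) else 0) - (if 1 - U ω < q then (1 : ℝ) else 0)) ^ 2
          + ((if q ≤ U ω then (1 : ℝ) else 0) - (if q ≤ 1 - U ω then (1 : ℝ) else 0)) ^ 2) ∂P
        ≤ 2)
    ∧
    ((∫ ω, (((if U ω < q then (1 : ℝ) else 0) - (if 1 - U ω < q then (1 : ℝ) else 0)) ^ 2
          + ((if q ≤ U ω then (1 : ℝ) else 0) - (if q ≤ 1 - U ω then (1 : ℝ) else 0)) ^ 2) ∂P
        = 2) ↔ q = 1 / 2) := by
  have key : ∫ ω, antitheticSqDist q (U ω) ∂P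
      = 2 - 2 * max (2 * q - 1) 0 - 2 * max (1 - 2 * q) 0 := by
    rw [← integral_antitheticSqDist hq, ← hU,
      integral_map hmU.aemeasurable (measurable_antitheticSqDist q).aestronglyMeasurable]
  simp only [antitheticSqDist] at key
  rw [key]
  grind
end

section
/- Let (Ω, 𝓕, P) be a probability space, let B_1,…,B_M be a measurable partition of Ω, let A be an event, and let C and D be events with D ⊆ C. Assume P(D) > 0, P(B_i ∩ D) > 0, P(B_i ∩ C) > 0 and P(A ∩ C) > 0, and assume the conditional independence relation P(A | B_i ∩ D) = P(A | B_i ∩ C) for every i = 1,…,M. Then P(A | D) = P(A | C) · Σ_{i=1}^{M} [ P(B_i | A ∩ C) · P(B_i | D) / P(B_i | C) ]. In the Markov switching context with A = {ξ_{t−1}' = e_m'}, B_i = {ξ_t' = e_i'}, C the event determined by y_{1:t−1} and D the event determined by y_{1:t}, this yields the one-period-ahead smoothing formula q(ξ_{t−1}' = e_m' | y_{1:t}) = q(ξ_{t−1}' = e_m' | y_{1:t−1}) Σ_{i=1}^{M} q(ξ_t' = e_i' | ξ_{t−1}' = e_m', y_{1:t−1}) · q(ξ_t' = e_i' | y_{1:t})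 / q(ξ_t' = e_i' | y_{1:t−1}). -/
open MeasureTheory

/-- Finite additivity over a finite measurable partition. -/
theorem measure_eq_sum_inter_of_partition {Ω ι : Type*} [MeasurableSpace Ω] [Fintype ι]
    (P : Measure Ω) {B : ι → Set Ω} (hBmeas : ∀ i, MeasurableSet (B i))
    (hBdisj : Pairwise (Function.onFun Disjoint B)) (hBcover : (⋃ i, B i) = Set.univ)
    {E : Set Ω} (hE : MeasurableSet E) : P E = ∑ i, P (B i ∩ E) := by
  have h : (⋃ i, B i ∩ E) = E := by
    rw [← Set.iUnion_inter, hBcover, Set.univ_inter]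
  rw [← tsum_fintype (L := .unconditional ι), ← measure_iUnion
    (fun i j hij => (hBdisj hij).mono Set.inter_subset_left Set.inter_subset_left)
    (fun i => (hBmeas i).inter hE), h]

/-- Cross-multiplication form of one summand of Bayes' rule in `ℝ≥0∞`. -/
theorem ENNReal.div_eq_mul_bayes_term {x y a b c d e : ENNReal}
    (hx : x ≠ ⊤) (hy : y ≠ ⊤) (ha : a ≠ ⊤) (hb : b ≠ ⊤) (hc : c ≠ ⊤) (he : e ≠ ⊤)
    (ha0 : a ≠ 0) (hb0 : b ≠ 0) (hc0 : c ≠ 0) (hd0 : d ≠ 0) (he0 : e ≠ 0)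
    (h : x / b = y / e) :
    x / d = (a / c) * ((y / a) * (b / d) / (e / c)) := by
  have hec : e / c ≠ 0 := ENNReal.div_ne_zero.2 ⟨he0, hc⟩
  rw [← ENNReal.toReal_eq_toReal_iff' (by finiteness) (by finiteness)]
  have h' := congrArg ENNReal.toReal h
  simp only [ENNReal.toReal_mul, ENNReal.toReal_div] at h' ⊢
  have ha' := ENNReal.toReal_ne_zero.2 ⟨ha0, ha⟩
  have hb' := ENNReal.toReal_ne_zero.2 ⟨hb0, hb⟩
  have hc' := ENNReal.toReal_ne_zero.2 ⟨hc0, hc⟩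
  have he' := ENNReal.toReal_ne_zero.2 ⟨he0, he⟩
  rw [div_eq_iff hb'] at h'
  rw [h']
  field_simp

/-- One-period-ahead smoothing formula (Dueker's approximation): for a measurable partition
`B_1, …, B_M` of `Ω`, events `A`, `C`, `D` with `D ⊆ C`, and the conditional independence
`P(A | B_i ∩ D) = P(A | B_i ∩ C)` for all `i`, one has
`P(A | D) = P(A | C) · Σ_i P(B_i | A ∩ C) · P(B_i | D) / P(B_i | C)`.
Conditional probabilities are written explicitly as ratios `P(X ∩ Y) / P(Y)`. -/
theorem one_period_ahead_smoothing_formula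
    {Ω : Type*} [MeasurableSpace Ω] (P : Measure Ω) [IsProbabilityMeasure P]
    (M : ℕ) (hM : 1 ≤ M)
    (B : Fin M → Set Ω) (hBmeas : ∀ i, MeasurableSet (B i))
    (hBdisj : Pairwise (Function.onFun Disjoint B)) (hBcover : (⋃ i, B i) = Set.univ)
    (A C D : Set Ω) (hA : MeasurableSet A) (hC : MeasurableSet C) (hD : MeasurableSet D)
    (hDC : D ⊆ C)
    (hDpos : 0 < P D) (hBiD : ∀ i, 0 < P (B i ∩ D)) (hBiC : ∀ i, 0 < P (B i ∩ C))
    (hACpos : 0 < P (A ∩ C))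
    (hCI : ∀ i, P (A ∩ (B i ∩ D)) / P (B i ∩ D) = P (A ∩ (B i ∩ C)) / P (B i ∩ C)) :
    P (A ∩ D) / P D
      = (P (A ∩ C) / P C)
        * ∑ i, (P (B i ∩ (A ∩ C)) / P (A ∩ C)) * (P (B i ∩ D) / P D) / (P (B i ∩ C) / P C) := by
  have hC0 : P C ≠ 0 := (hACpos.trans_le (measure_mono Set.inter_subset_right)).ne'
  have hsum := measure_eq_sum_inter_of_partition P hBmeas hBdisj hBcover (hA.inter hD)
  rw [hsum, div_eq_mul_inv, Finset.sum_mul, Finset.mul_sum]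
  refine Finset.sum_congr rfl fun i _ => ?_
  rw [← div_eq_mul_inv, Set.inter_left_comm (B i) A D, Set.inter_left_comm (B i) A C]
  exact ENNReal.div_eq_mul_bayes_term (measure_ne_top _ _) (measure_ne_top _ _)
    (measure_ne_top _ _) (measure_ne_top _ _) (measure_ne_top _ _) (measure_ne_top _ _)
    hACpos.ne' (hBiD i).ne' hC0 hDpos.ne' (hBiC i).ne' (hCI i)
end
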